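/- Let M be a matroid on a finite ground set U that is not the free matroid (i.e., 𝒞(M) ≠ ∅). If the union of all circuits of M equals U, i.e., ⋃𝒞(M) = U, then for every x ∈ U, overline{R(M)}(R(M)N(x)) = R(M)N(x). -/

import Mathlib

open Set

/-- A circuit of a matroid `M`: a minimal dependent subset of the ground set. -/
def IsCircuit {α : Type*} (M : Matroid α) (C : Set α) : Prop :=
  M.Dep C ∧ ∀ D, D ⊂ C → M.Indep D

/-- The relation `R(M)` induced from the matroid `M`:
`x R(M) y` iff there is a circuit of `M` containing both `x` and `y`. -/
def matroidRel {α : Type*} (M : Matroid α) (x y : α) : Prop :=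
  ∃ C, IsCircuit M C ∧ x ∈ C ∧ y ∈ C

/-- The successor neighborhood `R(M)N(x) = {y | x R(M) y}`. -/
def nbhd {α : Type*} (M : Matroid α) (x : α) : Set α :=
  {y | matroidRel M x y}

/-- The upper approximation of `X` with respect to `R(M)`. -/
def upperApprox {α : Type*} (M : Matroid α) (X : Set α) : Set α :=
  {x | (nbhd M x ∩ X).Nonempty}

lemma isCircuit_iff_matroid_isCircuit {α : Type*} {M : Matroid α} {C : Set α} :
    IsCircuit M C ↔ M.IsCircuit C :=
  Matroid.isCircuit_iff_forall_ssubset.symm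

/-- In a matroid, two elements lying in intersecting finite circuits lie in a common circuit. -/
lemma Matroid.IsCircuit.exists_isCircuit_of_inter_nonempty {α : Type*} {M : Matroid α}
    {C₁ C₂ : Set α} {x z : α} (h₁ : M.IsCircuit C₁) (h₂ : M.IsCircuit C₂) (hfin₁ : C₁.Finite)
    (hfin₂ : C₂.Finite) (hx : x ∈ C₁) (hz : z ∈ C₂) (hne : (C₁ ∩ C₂).Nonempty) :
    ∃ C, M.IsCircuit C ∧ x ∈ C ∧ z ∈ C := by
  induction hn : (C₁ ∪ C₂).ncard using Nat.strong_induction_on generalizing C₁ C₂ with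
  | _ n ih =>
  by_contra hcon
  have hfin := hfin₁.union hfin₂
  have hmin : ∀ D₁ D₂, M.IsCircuit D₁ → M.IsCircuit D₂ → x ∈ D₁ → z ∈ D₂ →
      (D₁ ∩ D₂).Nonempty → ¬ D₁ ∪ D₂ ⊂ C₁ ∪ C₂ := fun D₁ D₂ hD₁ hD₂ hxD hzD hD hss ↦
    hcon <| ih _ (hn ▸ Set.ncard_lt_ncard hss hfin) hD₁ hD₂
      (hfin.subset (subset_union_left.trans hss.subset))
      (hfin.subset (subset_union_right.trans hss.subset)) hxD hzD hD rfl
  have hx₂ : x ∉ C₂ := fun h ↦ hcon ⟨C₂, h₂, h, hz⟩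
  have hz₁ : z ∉ C₁ := fun h ↦ hcon ⟨C₁, h₁, hx, h⟩
  obtain ⟨y, hy₁, hy₂⟩ := hne
  obtain ⟨C₃, hC₃s, hC₃, hxC₃⟩ := h₁.strong_elimination h₂ hy₁ hy₂ hx hx₂
  obtain ⟨C₄, hC₄s, hC₄, hzC₄⟩ := h₂.strong_elimination h₁ hy₂ hy₁ hz hz₁
  obtain ⟨w, hw₃, hw₁⟩ : ∃ w ∈ C₃, w ∉ C₁ := Set.not_subset.1 fun h ↦
    (hC₃s (hC₃.eq_of_subset_isCircuit h₁ h ▸ hy₁)).2 rfl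
  obtain ⟨v, hv₄, hv₂⟩ : ∃ v ∈ C₄, v ∉ C₂ := Set.not_subset.1 fun h ↦
    (hC₄s (hC₄.eq_of_subset_isCircuit h₂ h ▸ hy₂)).2 rfl
  have hw₂ : w ∈ C₂ := (hC₃s hw₃).1.resolve_left hw₁
  have hv₁ : v ∈ C₁ := (hC₄s hv₄).1.resolve_left hv₂
  have hv₃ : v ∈ C₃ := by
    by_contra hv₃
    refine hmin C₃ C₂ hC₃ h₂ hxC₃ hz ⟨w, hw₃, hw₂⟩ ?_
    refine (Set.ssubset_iff_of_subset (Set.union_subset (fun a ha ↦ (hC₃s ha).1)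
      subset_union_right)).2 ⟨v, Or.inl hv₁, ?_⟩
    rintro (h | h) <;> contradiction
  refine hmin C₃ C₄ hC₃ hC₄ hxC₃ hzC₄ ⟨v, hv₃, hv₄⟩ ?_
  refine (Set.ssubset_iff_of_subset (Set.union_subset (fun a ha ↦ (hC₃s ha).1)
    fun a ha ↦ (hC₄s ha).1.symm)).2 ⟨y, Or.inl hy₁, ?_⟩
  rintro (h | h)
  · exact (hC₃s h).2 rfl
  · exact (hC₄s h).2 rfl

lemma matroidRel.symm {α : Type*} {M : Matroid α} {x y : α} (h : matroidRel M x y) :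
    matroidRel M y x := by
  obtain ⟨C, hC, hx, hy⟩ := h
  exact ⟨C, hC, hy, hx⟩

lemma matroidRel.trans {α : Type*} [Finite α] {M : Matroid α} {x y z : α}
    (hxy : matroidRel M x y) (hyz : matroidRel M y z) : matroidRel M x z := by
  obtain ⟨C₁, h₁, hx, hy₁⟩ := hxy
  obtain ⟨C₂, h₂, hy₂, hz⟩ := hyz
  rw [isCircuit_iff_matroid_isCircuit] at h₁ h₂
  obtain ⟨C, hC, hxC, hzC⟩ := h₁.exists_isCircuit_of_inter_nonempty h₂ C₁.toFinite C₂.toFinite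
    hx hz ⟨y, hy₁, hy₂⟩
  exact ⟨C, isCircuit_iff_matroid_isCircuit.2 hC, hxC, hzC⟩

theorem upperApprox_nbhd_eq_nbhd {α : Type*} [Fintype α]
    (M : Matroid α) (hE : M.E = Set.univ) (hM : {C | IsCircuit M C}.Nonempty)
    (hU : ⋃₀ {C | IsCircuit M C} = Set.univ) :
    ∀ x : α, upperApprox M (nbhd M x) = nbhd M x := by
  intro x
  ext y
  constructor
  · rintro ⟨z, hyz, hxz⟩
    exact matroidRel.trans hxz (matroidRel.symm hyz)
  · intro hxy
    obtain ⟨C, hC, hyC⟩ : y ∈ ⋃₀ {C | IsCircuit M C} := hU ▸ Set.mem_univ y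
    exact ⟨y, ⟨C, hC, hyC, hyC⟩, hxy⟩
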